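/- Let 1<p<2 and 0<ε<γ. There exists an integer K_0 such that for every integer K ≥ K_0 there exists a grid ε = r_0 < r_1 < ⋯ < r_K = γ satisfying 2r_{K−1} > r_K and the quasi-equidistribution condition r_{i−1}^{1−p} τ_i = r_i^{1−p} τ_{i+1} for all 1 ≤ i ≤ K−1. -/

import Mathlib

open Real

/-- The sequence starting at `ε` with increments `c * r ^ (p - 1)`. -/
noncomputable def powerStepSeq (p ε c : ℝ) : ℕ → ℝ
  | 0 => ε
  | n + 1 => powerStepSeq p ε c n + c * powerStepSeq p ε c n ^ (p - 1)

lemma continuous_powerStepSeq {p : ℝ} (hp : 1 ≤ p) (ε : ℝ) (n : ℕ) :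
    Continuous fun c => powerStepSeq p ε c n := by
  induction n with
  | zero => exact continuous_const
  | succ n ih => exact ih.add (continuous_id.mul (ih.rpow_const fun _ => Or.inr (by linarith)))

lemma powerStepSeq_zero_step (p ε : ℝ) (n : ℕ) : powerStepSeq p ε 0 n = ε := by
  induction n with
  | zero => rfl
  | succ n ih => simp [powerStepSeq, ih]

lemma le_powerStepSeq {p ε c : ℝ} (hp : 1 ≤ p) (hε : 0 ≤ ε) (hc : 0 ≤ c) (n : ℕ) :
    ε + n * (c * ε ^ (p - 1)) ≤ powerStepSeq p ε c n := by
  induction n with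
  | zero => simp [powerStepSeq]
  | succ n ih =>
    have hεr : ε ≤ powerStepSeq p ε c n := le_trans (le_add_of_nonneg_right (by positivity)) ih
    have hstep : c * ε ^ (p - 1) ≤ c * powerStepSeq p ε c n ^ (p - 1) :=
      mul_le_mul_of_nonneg_left (rpow_le_rpow hε hεr (by linarith)) hc
    simp only [powerStepSeq]
    push_cast
    linarith

/-- Remark after Lemma 4.3: for all sufficiently large `K` there exists a grid
`ε = r_0 < r_1 < ⋯ < r_K = γ` with `2 r_{K-1} > r_K` satisfying the
quasi-equidistribution condition. -/
theorem exists_quasi_equidistributed_grid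
    (p ε γ : ℝ) (hp1 : 1 < p) (hp2 : p < 2)
    (hε : 0 < ε) (hεγ : ε < γ) :
    ∃ K₀ : ℕ, ∀ K : ℕ, K₀ ≤ K →
      ∃ r : ℕ → ℝ, r 0 = ε ∧ r K = γ ∧
        (∀ i < K, r i < r (i + 1)) ∧
        2 * r (K - 1) > r K ∧
        (∀ i, 1 ≤ i → i ≤ K - 1 →
          (r (i - 1)) ^ (1 - p) * (r i - r (i - 1))
            = (r i) ^ (1 - p) * (r (i + 1) - r i)) := by
  obtain ⟨N, hN⟩ := exists_nat_gt ((γ - ε) / ε)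
  refine ⟨N + 1, fun K hK => ?_⟩
  have hεp : 0 < ε ^ (p - 1) := rpow_pos_of_pos hε _
  have hK0 : (0 : ℝ) < K := by exact_mod_cast (show 0 < K by omega)
  have hNK : (N : ℝ) ≤ K := by exact_mod_cast (show N ≤ K by omega)
  set C := (γ - ε) / (K * ε ^ (p - 1)) with hC
  have hC0 : 0 ≤ C := div_nonneg (by linarith) (by positivity)
  have hKC : K * (C * ε ^ (p - 1)) = γ - ε := by rw [hC]; field_simp
  have hend : γ ≤ powerStepSeq p ε C K := by
    linarith [le_powerStepSeq hp1.le hε.le hC0 K]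
  obtain ⟨c, ⟨hc0, hcC⟩, hcγ : powerStepSeq p ε c K = γ⟩ :=
    intermediate_value_Icc hC0 (continuous_powerStepSeq hp1.le ε K).continuousOn
      ⟨by simpa only [powerStepSeq_zero_step] using hεγ.le, hend⟩
  have hc : 0 < c := by
    refine hc0.lt_of_ne ?_
    rintro rfl
    rw [powerStepSeq_zero_step] at hcγ
    linarith
  have hle (i : ℕ) : ε ≤ powerStepSeq p ε c i :=
    le_trans (le_add_of_nonneg_right (by positivity)) (le_powerStepSeq hp1.le hε.le hc0 i)
  have hpos (i : ℕ) : 0 < powerStepSeq p ε c i := hε.trans_le (hle i)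
  have hquot (i : ℕ) : powerStepSeq p ε c i ^ (1 - p) *
      (powerStepSeq p ε c (i + 1) - powerStepSeq p ε c i) = c := by
    rw [powerStepSeq, add_sub_cancel_left, mul_left_comm, ← rpow_add (hpos i)]
    simp
  refine ⟨powerStepSeq p ε c, rfl, hcγ, fun i _ => ?_, ?_, fun i hi _ => ?_⟩
  · exact lt_add_of_pos_right _ (mul_pos hc (rpow_pos_of_pos (hpos i) _))
  · obtain ⟨k, rfl⟩ : ∃ k, K = k + 1 := ⟨K - 1, by omega⟩
    have hCε : C * ε ^ (p - 1) < ε := by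
      rw [div_lt_iff₀ hε] at hN
      nlinarith
    have hsplit {x : ℝ} (hx : 0 < x) : x ^ (p - 1) = x ^ (p - 2) * x := by
      rw [← rpow_add_one hx.ne']
      ring_nf
    have hCε' : C * ε ^ (p - 2) < 1 := by
      rw [hsplit hε] at hCε
      nlinarith
    have hlt : c * powerStepSeq p ε c k ^ (p - 2) < 1 :=
      (mul_le_mul hcC (rpow_le_rpow_of_nonpos hε (hle k) (by linarith))
        (rpow_pos_of_pos (hpos k) _).le hC0).trans_lt hCε'
    have hmul := mul_lt_mul_of_pos_right hlt (hpos k)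
    rw [mul_assoc, ← hsplit (hpos k), one_mul] at hmul
    simp only [add_tsub_cancel_right, powerStepSeq]
    linarith
  · obtain ⟨j, rfl⟩ : ∃ j, i = j + 1 := ⟨i - 1, by omega⟩
    simpa only [add_tsub_cancel_right] using (hquot j).trans (hquot (j + 1)).symm
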